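/- For every k ≥ 1 and tuples s = (s_1,…,s_k) of non-negative integers, i = (i_1,…,i_k) with 0 ≤ i_j < M, and m = (m_1,…,m_k) with 0 ≤ m_j < p, the function σ(s;i;m) lies in F_{M,σ}: there exist finitely many M-power series functions c_{(t,j)}, indexed by pairs of tuples (t,j), such that σ(s;i;m)(n) = Σ_{(t,j)} c_{(t,j)}(n)·σ_p(t;j)(n) for all n. Moreover, the indexing tuples can be chosen to satisfy t ≤ s. -/

import Mathlib

open Filter

noncomputable section

variable {K : Type*}

/-- Evaluation of the power series with coefficients `c` at the point `x`, as a `tsum`. -/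
def evalPS [NormedField K] (c : ℕ → K) (x : K) : K := ∑' m, c m * x ^ m

/-- The power series with coefficients `c` converges on the closed disc of radius `r`,
i.e. `‖c m‖ * r ^ m → 0`. -/
def PSConvOn [NormedField K] (c : ℕ → K) (r : ℝ) : Prop :=
  Filter.Tendsto (fun m => ‖c m‖ * r ^ m) Filter.atTop (nhds 0)

/-- `f`, regarded as a function on `{n : ℕ // n₀ ≤ n}`, is an `M`-power series function:
for every `i` with `0 < i ≤ pM` there is a power series `cᵢ` converging on a closed disc of
radius `rᵢ > |p| = 1/p` such that `f a = cᵢ (a - i)` for all `a ≥ n₀` with `pM ∣ a - i`. -/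
def IsMPSF (p M n₀ : ℕ) [NormedField K] (f : ℕ → K) : Prop :=
  ∀ i : ℕ, 0 < i → i ≤ p * M →
    ∃ (r : ℝ) (c : ℕ → K), (p : ℝ)⁻¹ < r ∧ PSConvOn c r ∧
      ∀ a : ℕ, n₀ ≤ a → ((p : ℤ) * M) ∣ ((a : ℤ) - (i : ℤ)) →
        f a = evalPS c ((a : K) - (i : K))

open scoped Classical in
/-- The cyclotomic `p`-adic iterated sum series `σ(s;i;m)(n)`: the sum of
`ζ^(i₁n₁+⋯+iₖnₖ)/(n₁^{s₁}⋯nₖ^{sₖ})` over all tuples `0 < n₁ < ⋯ < nₖ < n`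
with `p ∣ nⱼ - mⱼ` for every `j`. -/
def cycSum (p : ℕ) [Field K] (ζ : K) {k : ℕ} (s i m : Fin k → ℕ) (n : ℕ) : K :=
  ∑ t ∈ (Fintype.piFinset fun _ : Fin k => Finset.Ioo 0 n).filter
      (fun t : Fin k → ℕ => StrictMono t ∧ ∀ j, (p : ℤ) ∣ ((t j : ℤ) - (m j : ℤ))),
    ∏ j, ζ ^ (i j * t j) / (t j : K) ^ (s j)

/-- `σ_p(s;i) = σ(s;i;0)`. -/
def sigmaP (p : ℕ) [Field K] (ζ : K) {k : ℕ} (s i : Fin k → ℕ) : ℕ → K :=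
  cycSum p ζ s i fun _ => 0

/-- The index set of all pairs of tuples `(s, i)` with `s` a tuple of naturals and
`i` a tuple of residues mod `M`, of a common length `k ≥ 0`. -/
def SIdx (M : ℕ) : Type := Σ k : ℕ, (Fin k → ℕ) × (Fin k → Fin M)

/-- The function `σ_p(s;i)` attached to an index `u = (s, i)`. -/
def sigmaPIdx (p M : ℕ) [Field K] (ζ : K) (u : SIdx M) : ℕ → K :=
  sigmaP p ζ u.2.1 fun j => ((u.2.2 j : ℕ))

/-- `t ≤ s` for tuples: there is a strictly increasing reindexing `j` with `tₐ ≤ s_{j(a)}`. -/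
def TupleLE {l k : ℕ} (t : Fin l → ℕ) (s : Fin k → ℕ) : Prop :=
  ∃ j : Fin l → Fin k, StrictMono j ∧ ∀ a, t a ≤ s (j a)

/-! ### Power series with geometrically decaying coefficients -/

/-- The coefficients decay geometrically. -/
def PSDec [NormedField K] (c : ℕ → K) : Prop :=
  ∃ C r : ℝ, 0 ≤ C ∧ 0 < r ∧ r < 1 ∧ ∀ m, ‖c m‖ ≤ C * r ^ m

/-- Functions on the naturals given by an overconvergent power series. -/
def GoodFn [NormedField K] (h : ℕ → K) : Prop :=
  ∃ c : ℕ → K, PSDec c ∧ ∀ b : ℕ, h b = evalPS c (b : K)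

lemma linear_mul_pow_le {r : ℝ} (h0 : 0 < r) (h1 : r < 1) :
    ∃ C r' : ℝ, 0 ≤ C ∧ 0 < r' ∧ r' < 1 ∧ ∀ m : ℕ, ((m : ℝ) + 1) * r ^ m ≤ C * r' ^ m := by
  set r' : ℝ := (r + 1) / 2 with hr'
  have h2 : 0 < r' := by positivity
  have h3 : r < r' := by rw [hr']; linarith
  have h4 : r' < 1 := by rw [hr']; linarith
  set q := r / r' with hq
  have hq0 : 0 ≤ q := by positivity
  have hq1 : q < 1 := (div_lt_one h2).2 h3
  have hs : Tendsto (fun m : ℕ => (m : ℝ) * q ^ m + q ^ m) atTop (nhds (0 + 0)) :=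
    (tendsto_self_mul_const_pow_of_lt_one hq0 hq1).add (tendsto_pow_atTop_nhds_zero_of_lt_one hq0 hq1)
  obtain ⟨C, hC⟩ := hs.bddAbove_range
  have hC' : ∀ m : ℕ, (m : ℝ) * q ^ m + q ^ m ≤ C := fun m => hC ⟨m, rfl⟩
  refine ⟨C, r', ?_, h2, h4, fun m => ?_⟩
  · have := hC' 0
    simp at this
    linarith
  · have := mul_le_mul_of_nonneg_right (hC' m) (pow_nonneg h2.le m)
    have e : q ^ m * r' ^ m = r ^ m := by
      rw [← mul_pow, hq, div_mul_cancel₀ _ h2.ne']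
    calc ((m : ℝ) + 1) * r ^ m = ((m : ℝ) * q ^ m + q ^ m) * r' ^ m := by rw [← e]; ring
      _ ≤ _ := this

section
variable [NormedField K]

lemma PSDec.summable_norm {c : ℕ → K} (hc : PSDec c) {x : K} (hx : ‖x‖ ≤ 1) :
    Summable (fun m => ‖c m * x ^ m‖) := by
  obtain ⟨C, r, hC, h0, h1, h⟩ := hc
  refine Summable.of_nonneg_of_le (fun _ => norm_nonneg _) (fun m => ?_)
    ((summable_geometric_of_lt_one h0.le h1).mul_left C)
  rw [norm_mul, norm_pow]
  calc ‖c m‖ * ‖x‖ ^ m ≤ (C * r ^ m) * 1 := by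
        gcongr
        · exact h m
        · exact pow_le_one₀ (norm_nonneg _) hx
    _ = _ := mul_one _

lemma PSDec.add {c d : ℕ → K} (hc : PSDec c) (hd : PSDec d) : PSDec (fun m => c m + d m) := by
  obtain ⟨C, r, hC, h0, h1, h⟩ := hc
  obtain ⟨D, q, hD, g0, g1, g⟩ := hd
  refine ⟨C + D, max r q, by positivity, lt_max_of_lt_left h0, max_lt h1 g1, fun m => ?_⟩
  calc ‖c m + d m‖ ≤ ‖c m‖ + ‖d m‖ := norm_add_le _ _
    _ ≤ C * r ^ m + D * q ^ m := add_le_add (h m) (g m)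
    _ ≤ C * (max r q) ^ m + D * (max r q) ^ m := by
        gcongr
        · exact le_max_left _ _
        · exact le_max_right _ _
    _ = _ := by ring

lemma PSDec.mul {c d : ℕ → K} (hc : PSDec c) (hd : PSDec d) :
    PSDec (fun n => ∑ k ∈ Finset.range (n + 1), c k * d (n - k)) := by
  obtain ⟨C, r, hC, h0, h1, h⟩ := hc
  obtain ⟨D, q, hD, g0, g1, g⟩ := hd
  set R := max r q with hR
  have hR0 : 0 < R := lt_max_of_lt_left h0
  obtain ⟨E, R', hE, e0, e1, e⟩ := linear_mul_pow_le hR0 (max_lt h1 g1)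
  refine ⟨C * D * E, R', by positivity, e0, e1, fun n => ?_⟩
  calc ‖∑ k ∈ Finset.range (n + 1), c k * d (n - k)‖
      ≤ ∑ k ∈ Finset.range (n + 1), C * D * R ^ n := by
        refine norm_sum_le_of_le _ fun k hk => ?_
        have hk' : k ≤ n := Nat.lt_succ_iff.1 (Finset.mem_range.1 hk)
        rw [norm_mul]
        calc ‖c k‖ * ‖d (n - k)‖ ≤ (C * R ^ k) * (D * R ^ (n - k)) := by
              gcongr
              · exact (h k).trans (by gcongr; exact le_max_left _ _)
              · exact (g _).trans (by gcongr; exact le_max_right _ _)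
          _ = C * D * (R ^ k * R ^ (n - k)) := by ring
          _ = _ := by rw [← pow_add, Nat.add_sub_cancel' hk']
    _ = C * D * (((n : ℝ) + 1) * R ^ n) := by
        rw [Finset.sum_const, Finset.card_range, nsmul_eq_mul]; push_cast; ring
    _ ≤ C * D * (E * R' ^ n) := mul_le_mul_of_nonneg_left (e n) (by positivity)
    _ = _ := by ring

lemma PSDec.const_mul {c : ℕ → K} (hc : PSDec c) (a : K) : PSDec (fun m => a * c m) := by
  obtain ⟨C, r, hC, h0, h1, h⟩ := hc
  refine ⟨‖a‖ * C, r, by positivity, h0, h1, fun m => ?_⟩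
  rw [norm_mul, mul_assoc]
  gcongr
  exact h m

lemma PSDec.tail {c : ℕ → K} (hc : PSDec c) : PSDec (fun m => c (m + 1)) := by
  obtain ⟨C, r, hC, h0, h1, h⟩ := hc
  refine ⟨C * r, r, by positivity, h0, h1, fun m => ?_⟩
  refine (h (m + 1)).trans (le_of_eq ?_)
  ring

variable [CompleteSpace K]

lemma evalPS_add {c d : ℕ → K} (hc : PSDec c) (hd : PSDec d) {x : K} (hx : ‖x‖ ≤ 1) :
    evalPS (fun m => c m + d m) x = evalPS c x + evalPS d x := by
  unfold evalPS
  rw [← (hc.summable_norm hx).of_norm.tsum_add (hd.summable_norm hx).of_norm]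
  congr 1; ext m; ring

lemma evalPS_mul {c d : ℕ → K} (hc : PSDec c) (hd : PSDec d) {x : K} (hx : ‖x‖ ≤ 1) :
    evalPS (fun n => ∑ k ∈ Finset.range (n + 1), c k * d (n - k)) x = evalPS c x * evalPS d x := by
  unfold evalPS
  rw [tsum_mul_tsum_eq_tsum_sum_range_of_summable_norm (hc.summable_norm hx) (hd.summable_norm hx)]
  congr 1; ext n
  rw [Finset.sum_mul]
  refine Finset.sum_congr rfl fun k hk => ?_
  have hk' : k ≤ n := Nat.lt_succ_iff.1 (Finset.mem_range.1 hk)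
  have : x ^ n = x ^ k * x ^ (n - k) := by rw [← pow_add, Nat.add_sub_cancel' hk']
  rw [this]; ring

lemma evalPS_const_mul {c : ℕ → K} (a : K) (x : K) :
    evalPS (fun m => a * c m) x = a * evalPS c x := by
  unfold evalPS
  rw [← tsum_mul_left]
  congr 1; ext m; ring

lemma evalPS_tail {c : ℕ → K} (hc : PSDec c) {x : K} (hx : ‖x‖ ≤ 1) :
    evalPS c x = c 0 + x * evalPS (fun m => c (m + 1)) x := by
  unfold evalPS
  rw [(hc.summable_norm hx).of_norm.tsum_eq_zero_add, ← tsum_mul_left]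
  simp only [pow_zero, mul_one]
  congr 2; ext m; ring

/-- Transformation of a power series by a nearly triangular matrix. -/
lemma PSDec.transform {c : ℕ → K} (hc : PSDec c) (a : ℕ → ℕ → K)
    (ha0 : ∀ m l, m + 1 < l → a m l = 0) (ha : ∀ m l, ‖a m l‖ ≤ m + 1) :
    ∃ d : ℕ → K, PSDec d ∧ ∀ x : K, ‖x‖ ≤ 1 →
      ∑' m, c m * (∑ l ∈ Finset.range (m + 2), a m l * x ^ l) = evalPS d x := by
  obtain ⟨C, r, hC, h0, h1, h⟩ := hc
  obtain ⟨E, R, hE, e0, e1, e⟩ := linear_mul_pow_le h0 h1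
  set q := Real.sqrt R with hq
  have hq0 : 0 < q := Real.sqrt_pos.2 e0
  have hqq : q * q = R := Real.mul_self_sqrt e0.le
  have hq1 : q < 1 := by
    rw [hq]; calc Real.sqrt R < Real.sqrt 1 := Real.sqrt_lt_sqrt e0.le e1
      _ = 1 := Real.sqrt_one
  have key : ∀ m l, ‖c m * a m l‖ ≤ (C * E * q⁻¹) * (q ^ m * q ^ l) := by
    intro m l
    by_cases hl : m + 1 < l
    · rw [ha0 m l hl, mul_zero, norm_zero]; positivity
    · push Not at hl
      rw [norm_mul]
      calc ‖c m‖ * ‖a m l‖ ≤ (C * r ^ m) * (m + 1) := by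
            gcongr
            · exact h m
            · exact ha m l
        _ = C * ((m + 1) * r ^ m) := by ring
        _ ≤ C * (E * R ^ m) := mul_le_mul_of_nonneg_left (e m) hC
        _ = (C * E * q⁻¹) * (q ^ m * q ^ (m + 1)) := by
            rw [← hqq]; field_simp; ring
        _ ≤ _ := by
            gcongr ?_ * (?_ * ?_)
            exact pow_le_pow_of_le_one hq0.le hq1.le hl
  have hgeo := summable_geometric_of_lt_one hq0.le hq1
  refine ⟨fun l => ∑' m, c m * a m l, ⟨(C * E * q⁻¹) * (∑' m, q ^ m), q, ?_, hq0, hq1, ?_⟩, ?_⟩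
  · have : 0 ≤ ∑' m, q ^ m := tsum_nonneg fun m => by positivity
    positivity
  · intro l
    have hs : Summable fun m => (C * E * q⁻¹) * (q ^ m * q ^ l) := (hgeo.mul_right _).mul_left _
    refine (tsum_of_norm_bounded hs.hasSum fun m => key m l).trans (le_of_eq ?_)
    rw [tsum_mul_left, tsum_mul_right]; ring
  · intro x hx
    have hS : Summable (Function.uncurry fun m l => c m * a m l * x ^ l) := by
      have hprod : Summable fun z : ℕ × ℕ => (C * E * q⁻¹) * (q ^ z.1 * q ^ z.2) :=
        (hgeo.mul_of_nonneg hgeo (fun _ => by positivity) (fun _ => by positivity)).mul_left _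
      refine Summable.of_norm_bounded hprod fun z => ?_
      simp only [Function.uncurry]
      rw [norm_mul, norm_pow]
      calc ‖c z.1 * a z.1 z.2‖ * ‖x‖ ^ z.2 ≤ ‖c z.1 * a z.1 z.2‖ * 1 := by
            gcongr; exact pow_le_one₀ (norm_nonneg _) hx
        _ ≤ _ := by rw [mul_one]; exact key _ _
    unfold evalPS
    have e1 : ∀ m, c m * (∑ l ∈ Finset.range (m + 2), a m l * x ^ l)
        = ∑' l, c m * a m l * x ^ l := by
      intro m
      rw [tsum_eq_sum (s := Finset.range (m + 2)), Finset.mul_sum]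
      · exact Finset.sum_congr rfl fun l _ => by ring
      · intro l hl
        rw [ha0 m l (by simp at hl; omega)]; ring
    simp_rw [e1]
    rw [← hS.tsum_comm]
    congr 1; ext l
    rw [tsum_mul_right]

lemma PSDec.recenter (hn : ∀ n : ℕ, ‖(n : K)‖ ≤ 1) {c : ℕ → K} (hc : PSDec c) {β : K}
    (hβ : ‖β‖ ≤ 1) :
    ∃ d : ℕ → K, PSDec d ∧ ∀ x : K, ‖x‖ ≤ 1 → evalPS c (x + β) = evalPS d x := by
  obtain ⟨d, hd, h⟩ := hc.transform (fun m l => β ^ (m - l) * (m.choose l : K)) (by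
    intro m l hl
    rw [Nat.choose_eq_zero_of_lt (by omega)]; simp) (by
    intro m l
    rw [norm_mul, norm_pow]
    calc ‖β‖ ^ (m - l) * ‖(m.choose l : K)‖ ≤ 1 * 1 := by
          gcongr
          · exact pow_le_one₀ (norm_nonneg _) hβ
          · exact hn _
      _ ≤ m + 1 := by simp)
  refine ⟨d, hd, fun x hx => ?_⟩
  rw [← h x hx]
  unfold evalPS
  congr 1; ext m
  rw [Finset.sum_range_succ, add_pow]
  simp only [Nat.choose_succ_self, Nat.cast_zero, mul_zero, zero_mul, add_zero]
  congr 1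
  exact Finset.sum_congr rfl fun l _ => by ring

lemma GoodFn.const (a : K) : GoodFn (fun _ : ℕ => a) := by
  refine ⟨fun m => if m = 0 then a else 0, ⟨‖a‖, 1 / 2, norm_nonneg _, by norm_num, by norm_num, ?_⟩, ?_⟩
  · intro m
    rcases Nat.eq_zero_or_pos m with rfl | hm
    · simp
    · simp only [if_neg hm.ne', norm_zero]; positivity
  · intro b
    unfold evalPS
    rw [tsum_eq_single 0]
    · simp
    · intro m hm; simp [hm]

lemma GoodFn.add (hn : ∀ n : ℕ, ‖(n : K)‖ ≤ 1) {f g : ℕ → K} (hf : GoodFn f) (hg : GoodFn g) :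
    GoodFn (fun b => f b + g b) := by
  obtain ⟨c, hc, h⟩ := hf
  obtain ⟨d, hd, h'⟩ := hg
  exact ⟨_, hc.add hd, fun b => by beta_reduce; rw [h, h', evalPS_add hc hd (hn b)]⟩

lemma GoodFn.mul (hn : ∀ n : ℕ, ‖(n : K)‖ ≤ 1) {f g : ℕ → K} (hf : GoodFn f) (hg : GoodFn g) :
    GoodFn (fun b => f b * g b) := by
  obtain ⟨c, hc, h⟩ := hf
  obtain ⟨d, hd, h'⟩ := hg
  exact ⟨_, hc.mul hd, fun b => by beta_reduce; rw [h, h', evalPS_mul hc hd (hn b)]⟩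

lemma GoodFn.shift (hn : ∀ n : ℕ, ‖(n : K)‖ ≤ 1) {f : ℕ → K} (hf : GoodFn f) (e : ℕ) :
    GoodFn (fun b => f (e + b)) := by
  obtain ⟨c, hc, h⟩ := hf
  obtain ⟨d, hd, h'⟩ := hc.recenter hn (hn e)
  exact ⟨d, hd, fun b => by beta_reduce; rw [h, ← h' _ (hn b), Nat.cast_add, add_comm]⟩

lemma GoodFn.sum (hn : ∀ n : ℕ, ‖(n : K)‖ ≤ 1) {ι : Type*} (S : Finset ι) (f : ι → ℕ → K)
    (hf : ∀ j ∈ S, GoodFn (f j)) : GoodFn (fun b => ∑ j ∈ S, f j b) := by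
  classical
  induction S using Finset.induction_on with
  | empty => simpa using GoodFn.const (0 : K)
  | insert j S hj ih =>
    simp only [Finset.sum_insert hj]
    exact (hf j (by simp)).add hn (ih fun k hk => hf k (by simp [hk]))

/-- Geometric series. -/
lemma GoodFn.inv_linear (hn : ∀ n : ℕ, ‖(n : K)‖ ≤ 1) {u v : K} (hu : ‖u‖ = 1) (hv : ‖v‖ < 1) :
    GoodFn (fun b => (u + v * b)⁻¹) := by
  have hu0 : u ≠ 0 := by
    intro h; rw [h, norm_zero] at hu; exact zero_ne_one hu
  refine ⟨fun m => u⁻¹ * (-(v * u⁻¹)) ^ m, ⟨1, (‖v‖ + 1) / 2, zero_le_one, by positivity, by linarith, ?_⟩, ?_⟩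
  · intro m
    rw [norm_mul, norm_inv, norm_pow, norm_neg, norm_mul, norm_inv, hu]
    simp only [inv_one, one_mul, mul_one]
    gcongr
    linarith
  · intro b
    unfold evalPS
    have : ∀ m, u⁻¹ * (-(v * u⁻¹)) ^ m * (b : K) ^ m = u⁻¹ * (-(v * u⁻¹) * b) ^ m := by
      intro m; rw [mul_pow]; ring
    simp_rw [this]
    have hlt : ‖-(v * u⁻¹) * b‖ < 1 := by
      rw [norm_mul, norm_neg, norm_mul, norm_inv, hu, inv_one, mul_one]
      calc ‖v‖ * ‖(b : K)‖ ≤ ‖v‖ * 1 := by gcongr; exact hn b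
        _ < 1 := by simpa using hv
    rw [tsum_mul_left, tsum_geometric_of_norm_lt_one hlt, ← mul_inv]
    congr 1
    field_simp
    ring

/-- Dividing by a linear factor. -/
lemma GoodFn.div_linear (hn : ∀ n : ℕ, ‖(n : K)‖ ≤ 1) {f : ℕ → K} (hf : GoodFn f) {β : K}
    (hβ : ‖β‖ ≤ 1) (hβ' : ∀ b : ℕ, ‖(b : K) + β‖ ≤ 1) :
    ∃ (κ : K) (g : ℕ → K), GoodFn g ∧ ∀ b : ℕ, f b = κ + (b + β) * g b := by
  obtain ⟨c, hc, h⟩ := hf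
  obtain ⟨d, hd, h'⟩ := hc.recenter hn (β := -β) (by rwa [norm_neg])
  obtain ⟨e, he, h''⟩ := hd.tail.recenter hn hβ
  refine ⟨d 0, fun b => evalPS e b, ⟨e, he, fun b => rfl⟩, fun b => ?_⟩
  beta_reduce
  rw [← h'' _ (hn b), ← evalPS_tail hd (hβ' b), ← h' _ (hβ' b), h]
  congr 1; ring

lemma pow_eq_sum_stirling (b m : ℕ) :
    b ^ m = ∑ k ∈ Finset.range (m + 1), Nat.stirlingSecond m k * b.descFactorial k := by
  induction m with
  | zero => simp
  | succ m ih =>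
    have hk : ∀ k, b * b.descFactorial k = b.descFactorial (k + 1) + k * b.descFactorial k := by
      intro k
      rw [Nat.descFactorial_succ, ← add_mul]
      rcases le_or_gt k b with h | h
      · rw [Nat.sub_add_cancel h]
      · rw [Nat.descFactorial_eq_zero_iff_lt.2 h]; simp
    rw [pow_succ, ih, Finset.sum_mul, Finset.sum_range_succ' _ (m + 1)]
    simp only [Nat.stirlingSecond_succ_succ, Nat.stirlingSecond_succ_zero, zero_mul, add_zero]
    have e1 : ∀ k, Nat.stirlingSecond m k * b.descFactorial k * b
        = Nat.stirlingSecond m k * b.descFactorial (k + 1)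
          + k * (Nat.stirlingSecond m k * b.descFactorial k) := by
      intro k
      have := hk k
      calc Nat.stirlingSecond m k * b.descFactorial k * b
          = Nat.stirlingSecond m k * (b * b.descFactorial k) := by ring
        _ = _ := by rw [this]; ring
    simp only [e1, add_mul, Finset.sum_add_distrib]
    rw [add_comm]
    congr 1
    have e2 := Finset.sum_range_succ'
      (fun k => k * (Nat.stirlingSecond m k * b.descFactorial k)) (m + 1)
    have e3 := Finset.sum_range_succ
      (fun k => k * (Nat.stirlingSecond m k * b.descFactorial k)) (m + 1)
    rw [Nat.stirlingSecond_eq_zero_of_lt (Nat.lt_succ_self m)] at e3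
    simp only [zero_mul, mul_zero, add_zero] at e2 e3
    rw [← e3, e2, ← Finset.sum_add_distrib]
    exact Finset.sum_congr rfl fun k _ => by ring

lemma sum_descFactorial (n k : ℕ) :
    (k + 1) * ∑ b ∈ Finset.range n, b.descFactorial k = n.descFactorial (k + 1) := by
  induction n with
  | zero => simp
  | succ n ih =>
    rw [Finset.sum_range_succ, mul_add, ih, Nat.succ_descFactorial_succ, Nat.descFactorial_succ,
      ← add_mul]
    rcases le_or_gt k n with h | h
    · congr 1; omega
    · rw [Nat.descFactorial_eq_zero_iff_lt.2 h]; simp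

/-- Power sums as polynomials with controlled coefficients. -/
lemma exists_powerSum_coeffs [CharZero K] [IsUltrametricDist K] (hn : ∀ n : ℕ, ‖(n : K)‖ ≤ 1)
    (hinv : ∀ k : ℕ, ‖((k : K) + 1)⁻¹‖ ≤ k + 1) (m : ℕ) :
    ∃ a : ℕ → K, (∀ l, m + 1 < l → a l = 0) ∧ (∀ l, ‖a l‖ ≤ m + 1) ∧
      ∀ n : ℕ, ∑ l ∈ Finset.range (m + 2), a l * (n : K) ^ l
        = ∑ b ∈ Finset.range n, (b : K) ^ m := by
  set P : Polynomial K := ∑ k ∈ Finset.range (m + 1),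
    Polynomial.C ((Nat.stirlingSecond m k : K) * ((k : K) + 1)⁻¹) * descPochhammer K (k + 1) with hP
  have hdeg : P.natDegree < m + 2 := by
    refine Nat.lt_succ_iff.2 (Polynomial.natDegree_sum_le_of_forall_le _ _ fun k hk => ?_)
    refine (Polynomial.natDegree_C_mul_le _ _).trans ?_
    rw [descPochhammer_natDegree]
    have := Finset.mem_range.1 hk
    omega
  refine ⟨P.coeff, fun l hl => Polynomial.coeff_eq_zero_of_natDegree_lt (by omega), fun l => ?_,
    fun n => ?_⟩
  · rw [hP, Polynomial.finsetSum_coeff]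
    refine IsUltrametricDist.norm_sum_le_of_forall_le_of_nonneg (by positivity) fun k hk => ?_
    rw [Polynomial.coeff_C_mul, ← descPochhammer_map (Int.castRingHom K), Polynomial.coeff_map,
      norm_mul, norm_mul]
    have hz : ∀ z : ℤ, ‖(z : K)‖ ≤ 1 := by
      intro z
      rcases z.eq_nat_or_neg with ⟨n, rfl | rfl⟩
      · simpa using hn n
      · simpa using hn n
    have hk' : (k : ℝ) ≤ m := by
      exact_mod_cast Nat.lt_succ_iff.1 (Finset.mem_range.1 hk)
    calc _ ≤ 1 * ((k : ℝ) + 1) * 1 := by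
          gcongr
          · exact hn _
          · exact hinv k
          · exact hz _
      _ ≤ _ := by linarith
  · rw [← Polynomial.eval_eq_sum_range' hdeg, hP, Polynomial.eval_finsetSum]
    have e1 : ∀ k, Polynomial.eval (n : K) (Polynomial.C ((Nat.stirlingSecond m k : K) * ((k : K) + 1)⁻¹)
        * descPochhammer K (k + 1))
        = ∑ b ∈ Finset.range n, (Nat.stirlingSecond m k : K) * (b.descFactorial k : K) := by
      intro k
      rw [Polynomial.eval_C_mul, descPochhammer_eval_eq_descFactorial, ← sum_descFactorial,
        ← Finset.mul_sum, mul_assoc]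
      push_cast
      have : (k : K) + 1 ≠ 0 := Nat.cast_add_one_ne_zero k
      rw [← mul_assoc ((k : K) + 1)⁻¹, inv_mul_cancel₀ this, one_mul]
    simp_rw [e1]
    rw [Finset.sum_comm]
    refine Finset.sum_congr rfl fun b _ => ?_
    have := pow_eq_sum_stirling b m
    exact_mod_cast this.symm

/-- Indefinite summation preserves good functions. -/
lemma GoodFn.indefSum [CharZero K] [IsUltrametricDist K] (hn : ∀ n : ℕ, ‖(n : K)‖ ≤ 1)
    (hinv : ∀ k : ℕ, ‖((k : K) + 1)⁻¹‖ ≤ k + 1) {f : ℕ → K} (hf : GoodFn f) :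
    GoodFn (fun n => ∑ b ∈ Finset.range n, f b) := by
  obtain ⟨c, hc, h⟩ := hf
  choose a h0 h1 h2 using exists_powerSum_coeffs (K := K) hn hinv
  obtain ⟨d, hd, h'⟩ := hc.transform a h0 h1
  refine ⟨d, hd, fun n => ?_⟩
  rw [← h' _ (hn n)]
  simp_rw [h2, h, Finset.mul_sum]
  unfold evalPS
  rw [Summable.tsum_finsetSum]
  exact fun b _ => (hc.summable_norm (hn b)).of_norm

end
/-! ### The algebra of functions that are good on every arithmetic progression mod `d` -/

/-- `f` is good on every progression of step `d`. -/
def AFn [NormedField K] (d : ℕ) (f : ℕ → K) : Prop := ∀ i : ℕ, GoodFn (fun b => f (i + d * b))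

section
variable [NormedField K] [CompleteSpace K] {d : ℕ}

lemma AFn.periodic {f : ℕ → K} (h : ∀ a b, f (a + d * b) = f a) : AFn d f := by
  intro i
  simp only [h]
  exact GoodFn.const _

lemma AFn.const (a : K) : AFn d (fun _ => a) := AFn.periodic fun _ _ => rfl

lemma AFn.add (hn : ∀ n : ℕ, ‖(n : K)‖ ≤ 1) {f g : ℕ → K} (hf : AFn d f) (hg : AFn d g) :
    AFn d (fun a => f a + g a) := fun i => (hf i).add hn (hg i)

lemma AFn.mul (hn : ∀ n : ℕ, ‖(n : K)‖ ≤ 1) {f g : ℕ → K} (hf : AFn d f) (hg : AFn d g) :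
    AFn d (fun a => f a * g a) := fun i => (hf i).mul hn (hg i)

lemma AFn.id (hn : ∀ n : ℕ, ‖(n : K)‖ ≤ 1) : AFn d (fun a => (a : K)) := by
  have hid : GoodFn (fun b : ℕ => (b : K)) := by
    refine ⟨fun m => if m = 1 then 1 else 0,
      ⟨2, 1 / 2, by norm_num, by norm_num, by norm_num, ?_⟩, ?_⟩
    · intro m
      by_cases hm : m = 1
      · subst hm; simp
      · simp only [if_neg hm, norm_zero]; positivity
    · intro b
      unfold evalPS
      rw [tsum_eq_single 1]
      · simp
      · intro m hm; simp [hm]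
  intro i
  have := (GoodFn.const (i : K)).add hn ((GoodFn.const (d : K)).mul hn hid)
  simpa using this

lemma AFn.pow (hn : ∀ n : ℕ, ‖(n : K)‖ ≤ 1) {f : ℕ → K} (hf : AFn d f) (s : ℕ) :
    AFn d (fun a => f a ^ s) := by
  induction s with
  | zero => simpa using AFn.const (d := d) (1 : K)
  | succ s ih => simpa only [pow_succ] using ih.mul hn hf

lemma AFn.succ {f : ℕ → K} (hf : AFn d f) : AFn d (fun a => f (a + 1)) := by
  intro i
  have := hf (i + 1)
  simpa only [add_right_comm i 1] using this

lemma sum_range_progression (f : ℕ → K) (d i n : ℕ) :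
    ∑ a ∈ Finset.range (i + d * n), f a = ∑ a ∈ Finset.range i, f a
      + ∑ b ∈ Finset.range n, ∑ j ∈ Finset.range d, f (i + j + d * b) := by
  induction n with
  | zero => simp
  | succ n ih =>
    rw [Nat.mul_succ, ← add_assoc, Finset.sum_range_add, ih, Finset.sum_range_succ, add_assoc]
    congr 2
    exact Finset.sum_congr rfl fun j _ => by rw [add_right_comm]

lemma AFn.indefSum [CharZero K] [IsUltrametricDist K] (hn : ∀ n : ℕ, ‖(n : K)‖ ≤ 1)
    (hinv : ∀ k : ℕ, ‖((k : K) + 1)⁻¹‖ ≤ k + 1) {f : ℕ → K} (hf : AFn d f) :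
    AFn d (fun n => ∑ a ∈ Finset.range n, f a) := by
  intro i
  simp only [sum_range_progression]
  refine (GoodFn.const _).add hn (GoodFn.indefSum hn hinv ?_)
  exact GoodFn.sum hn _ _ fun j _ => hf (i + j)

/-- The inverse function, restricted to the integers prime to `p`. -/
lemma AFn.inv (hn : ∀ n : ℕ, ‖(n : K)‖ ≤ 1) {p : ℕ} (hpd : p ∣ d)
    (hu : ∀ a : ℕ, ¬ p ∣ a → ‖(a : K)‖ = 1) (hd : ‖(d : K)‖ < 1) :
    AFn d (fun a => if p ∣ a then (0 : K) else (a : K)⁻¹) := by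
  intro i
  have hdvd : ∀ b, p ∣ i + d * b ↔ p ∣ i := fun b =>
    (Nat.dvd_add_iff_left (hpd.mul_right b)).symm
  simp only [hdvd]
  by_cases h : p ∣ i
  · simp only [if_pos h]; exact GoodFn.const _
  · simp only [if_neg h]
    have := GoodFn.inv_linear hn (hu i h) hd
    simpa using this

/-- Division with remainder by the identity function on multiples of `p`. -/
lemma AFn.div_id [CharZero K] (hn : ∀ n : ℕ, ‖(n : K)‖ ≤ 1) {p M : ℕ} (hp : 0 < p) (hM : 0 < M)
    (hMu : ‖(M : K)‖ = 1) {f : ℕ → K} (hf : AFn (p * M) f) :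
    ∃ (κ : ℕ → K) (g : ℕ → K), AFn (p * M) g ∧
      ∀ a, f (p * a) = κ (a % M) + ((p * a : ℕ) : K) * g (p * a) := by
  have hp0 : (p : K) ≠ 0 := Nat.cast_ne_zero.2 hp.ne'
  have hM0 : (M : K) ≠ 0 := Nat.cast_ne_zero.2 hM.ne'
  have step : ∀ i : ℕ, ∃ (κ : K) (g : ℕ → K), GoodFn g ∧
      ∀ b : ℕ, f (p * i + p * M * b) = κ + ((p * i + p * M * b : ℕ) : K) * g b := by
    intro i
    obtain ⟨κ, g, hg, h⟩ := (hf (p * i)).div_linear hn (β := (i : K) / M) (by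
      rw [norm_div, hMu, div_one]; exact hn i) (by
      intro b
      have : (b : K) + (i : K) / M = ((b * M + i : ℕ) : K) / M := by
        push_cast; field_simp
      rw [this, norm_div, hMu, div_one]; exact hn _)
    refine ⟨κ, fun b => ((p : K) * M)⁻¹ * g b, (GoodFn.const _).mul hn hg, fun b => ?_⟩
    rw [h b]
    push_cast
    field_simp
    ring
  choose κ g hg h using step
  refine ⟨κ, fun a => if p ∣ a then g ((a / p) % M) ((a / p) / M) else 0, ?_, ?_⟩
  · intro i
    have hdvd : ∀ b, p ∣ i + p * M * b ↔ p ∣ i := fun b =>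
      (Nat.dvd_add_iff_left (Dvd.intro _ (mul_assoc p M b).symm)).symm
    simp only [hdvd]
    by_cases hi : p ∣ i
    · obtain ⟨i', rfl⟩ := hi
      have e : ∀ b, (p * i' + p * M * b) / p = i' + M * b := by
        intro b
        rw [mul_assoc, ← mul_add, Nat.mul_div_cancel_left _ hp]
      simp only [dvd_mul_right, if_true, e, Nat.add_mul_mod_self_left, Nat.add_mul_div_left _ _ hM]
      exact (hg (i' % M)).shift hn (i' / M)
    · simp only [if_neg hi]; exact GoodFn.const _
  · intro a
    have e : p * a = p * (a % M) + p * M * (a / M) := by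
      rw [mul_assoc, ← mul_add, Nat.mod_add_div]
    have := h (a % M) (a / M)
    rw [← e] at this
    simp only [dvd_mul_right, if_true, Nat.mul_div_cancel_left _ hp]
    exact this

/-- Finite Fourier inversion. -/
lemma exists_fourier {M : ℕ} (hM : 0 < M) {ξ : K} (hξ : IsPrimitiveRoot ξ M) (κ : ℕ → K) :
    ∃ k : ℕ → K, ∀ a : ℕ, κ (a % M) = ∑ j ∈ Finset.range M, k j * ξ ^ (j * a) := by
  have hinj : Set.InjOn (fun a : ℕ => ξ ^ a) (Finset.range M : Set ℕ) := by
    intro a ha b hb hab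
    exact hξ.pow_inj (by simpa using ha) (by simpa using hb) hab
  refine ⟨(Lagrange.interpolate (Finset.range M) (fun a : ℕ => ξ ^ a) κ).coeff, fun a => ?_⟩
  have hlt : a % M < M := Nat.mod_lt _ hM
  have h1 := Lagrange.eval_interpolate_at_node κ hinj (Finset.mem_range.2 hlt)
  rw [← h1, Polynomial.eval_eq_sum_range' (n := M)]
  · refine Finset.sum_congr rfl fun j _ => ?_
    rw [hξ.eq_orderOf, pow_mod_orderOf, ← pow_mul, mul_comm a j]
  · have := Lagrange.degree_interpolate_lt κ hinj
    rw [Finset.card_range] at this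
    by_cases h0 : Lagrange.interpolate (Finset.range M) (fun a : ℕ => ξ ^ a) κ = 0
    · rw [h0]; simpa using hM
    · exact (Polynomial.natDegree_lt_iff_degree_lt h0).2 this

lemma AFn.isMPSF (hn : ∀ n : ℕ, ‖(n : K)‖ ≤ 1) {p M : ℕ} (hp : 0 < p) (hM : 0 < M)
    (hpM : ‖((p * M : ℕ) : K)‖ = (p : ℝ)⁻¹) {f : ℕ → K} (hf : AFn (p * M) f) :
    IsMPSF p M 0 f := by
  intro i hi0 hi
  have hz : ∀ z : ℤ, ‖(z : K)‖ ≤ 1 := by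
    intro z
    rcases z.eq_nat_or_neg with ⟨n, rfl | rfl⟩
    · simpa using hn n
    · simpa using hn n
  set D := p * M with hD
  have hD0 : 0 < D := Nat.mul_pos hp hM
  have hp' : (0 : ℝ) < p := Nat.cast_pos.2 hp
  have hDK : (D : K) ≠ 0 := by
    rw [← norm_ne_zero_iff, hpM]; positivity
  obtain ⟨c, hc, h⟩ := hf (i % D)
  obtain ⟨c', hc', h'⟩ := hc.recenter hn (hn (i / D))
  obtain ⟨C, r, hC, h0, h1, hb⟩ := hc'
  refine ⟨2 / (1 + r) * (p : ℝ)⁻¹, fun m => c' m * ((D : K)⁻¹) ^ m, ?_, ?_, ?_⟩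
  · have : 1 < 2 / (1 + r) := by rw [lt_div_iff₀ (by positivity)]; linarith
    have hpi : 0 < (p : ℝ)⁻¹ := by positivity
    nlinarith
  · unfold PSConvOn
    have hq : 2 * r / (1 + r) < 1 := by rw [div_lt_one (by positivity)]; linarith
    have ht : Tendsto (fun m : ℕ => C * (2 * r / (1 + r)) ^ m) atTop (nhds (C * 0)) :=
      (tendsto_pow_atTop_nhds_zero_of_lt_one (by positivity) hq).const_mul C
    rw [mul_zero] at ht
    refine squeeze_zero (fun m => by positivity) (fun m => ?_) ht
    rw [norm_mul, norm_pow, norm_inv, hpM, inv_inv]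
    calc ‖c' m‖ * (p : ℝ) ^ m * (2 / (1 + r) * (p : ℝ)⁻¹) ^ m
        = ‖c' m‖ * (2 / (1 + r)) ^ m := by
          rw [mul_assoc, ← mul_pow]; congr 2; field_simp
      _ ≤ (C * r ^ m) * (2 / (1 + r)) ^ m := by gcongr; exact hb m
      _ = _ := by rw [mul_assoc, ← mul_pow]; congr 2; ring
  · intro a _ hdvd
    have hmod : a % D = i % D := by
      have : (D : ℤ) ∣ (i : ℤ) - a := by
        rw [← Int.dvd_neg, neg_sub, hD]; push_cast; exact hdvd
      exact (Nat.modEq_iff_dvd.2 this)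
    have ea : a = i % D + D * (a / D) := by rw [← hmod, Nat.mod_add_div]
    have ei : i = i % D + D * (i / D) := by rw [Nat.mod_add_div]
    have eK : (a : K) - (i : K) = D * (((a / D : ℕ) : K) - ((i / D : ℕ) : K)) := by
      conv_lhs => rw [ea, ei]
      simp only [Nat.add_mul_mod_self_left, Nat.mod_mod, Nat.cast_add, Nat.cast_mul]
      ring
    have := h (a / D)
    beta_reduce at this
    rw [← ea] at this
    rw [this, eK]
    have hx : ‖((a / D : ℕ) : K) - ((i / D : ℕ) : K)‖ ≤ 1 := by
      have := hz ((a / D : ℕ) - (i / D : ℕ) : ℤ)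
      simpa only [Int.cast_sub, Int.cast_natCast] using this
    have e2 := h' _ hx
    rw [sub_add_cancel] at e2
    rw [e2]
    unfold evalPS
    congr 1; ext m
    rw [mul_pow, mul_assoc, ← mul_assoc _ ((D : K) ^ m), ← mul_pow, inv_mul_cancel₀ hDK, one_pow,
      one_mul]

end
/-! ### Combinatorics of the iterated sums -/

lemma strictMono_init_iff {k : ℕ} (t : Fin (k + 1) → ℕ) :
    StrictMono t ↔ StrictMono (Fin.init t) ∧ ∀ j, Fin.init t j < t (Fin.last k) := by
  constructor
  · intro h
    exact ⟨fun a b hab => h (Fin.castSucc_lt_castSucc_iff.2 hab), fun j => h (Fin.castSucc_lt_last j)⟩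
  · rintro ⟨h1, h2⟩ a b hab
    induction b using Fin.lastCases with
    | last =>
      induction a using Fin.lastCases with
      | last => exact absurd hab (lt_irrefl _)
      | cast a => exact h2 a
    | cast b =>
      induction a using Fin.lastCases with
      | last => exact absurd hab (not_lt.2 (Fin.le_last _))
      | cast a => exact h1 (Fin.castSucc_lt_castSucc_iff.1 hab)

lemma cycSum_succ (p : ℕ) [Field K] (ζ : K) {k : ℕ} (s i m : Fin (k + 1) → ℕ) (n : ℕ) :
    cycSum p ζ s i m n = ∑ a ∈ Finset.range n,
      (if 0 < a ∧ (p : ℤ) ∣ ((a : ℤ) - (m (Fin.last k) : ℤ)) then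
        ζ ^ (i (Fin.last k) * a) / (a : K) ^ s (Fin.last k) else 0)
      * cycSum p ζ (Fin.init s) (Fin.init i) (Fin.init m) a := by
  classical
  simp only [ite_mul, zero_mul]
  rw [← Finset.sum_filter]
  unfold cycSum
  simp only [Finset.mul_sum]
  rw [Finset.sum_sigma']
  refine Finset.sum_bij' (fun t _ => ⟨t (Fin.last k), Fin.init t⟩)
    (fun x _ => Fin.snoc (α := fun _ => ℕ) x.2 x.1) ?_ ?_ ?_ ?_ ?_
  · intro t ht
    simp only [Finset.mem_filter, Fintype.mem_piFinset, Finset.mem_Ioo, strictMono_init_iff] at ht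
    obtain ⟨h1, ⟨h2, h3⟩, h4⟩ := ht
    simp only [Finset.mem_sigma, Finset.mem_filter, Finset.mem_range, Fintype.mem_piFinset,
      Finset.mem_Ioo]
    exact ⟨⟨(h1 _).2, (h1 _).1, h4 _⟩, fun j => ⟨(h1 j.castSucc).1, h3 j⟩, h2,
      fun j => h4 j.castSucc⟩
  · rintro ⟨a, t⟩ hx
    simp only [Finset.mem_sigma, Finset.mem_filter, Finset.mem_range, Fintype.mem_piFinset,
      Finset.mem_Ioo] at hx
    obtain ⟨⟨h1, h2, h3⟩, h4, h5, h6⟩ := hx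
    simp only [Finset.mem_filter, Fintype.mem_piFinset, Finset.mem_Ioo, strictMono_init_iff,
      Fin.forall_fin_succ', Fin.snoc_castSucc, Fin.snoc_last, Fin.init_snoc]
    exact ⟨⟨fun j => ⟨(h4 j).1, (h4 j).2.trans h1⟩, h2, h1⟩, ⟨h5, fun j => (h4 j).2⟩, h6, h3⟩
  · intro t _
    exact Fin.snoc_init_self t
  · rintro ⟨a, t⟩ _
    simp
  · intro t _
    rw [Fin.prod_univ_castSucc, mul_comm]
    rfl

lemma cycSum_zero (p : ℕ) [Field K] (ζ : K) (s i m : Fin 0 → ℕ) (n : ℕ) :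
    cycSum p ζ s i m n = 1 := by
  classical
  unfold cycSum
  rw [Finset.filter_true_of_mem]
  · simp
  · intro t _
    exact ⟨fun a => a.elim0, fun j => j.elim0⟩

lemma sigmaPIdx_succ (p M : ℕ) [Field K] (ζ : K) {l : ℕ} (t : Fin (l + 1) → ℕ)
    (j : Fin (l + 1) → Fin M) (n : ℕ) :
    sigmaPIdx p M ζ ⟨l + 1, t, j⟩ n = ∑ a ∈ Finset.range n,
      (if 0 < a ∧ p ∣ a then
        ζ ^ ((j (Fin.last l) : ℕ) * a) / (a : K) ^ t (Fin.last l) else 0)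
      * sigmaPIdx p M ζ ⟨l, Fin.init t, Fin.init j⟩ a := by
  unfold sigmaPIdx sigmaP
  rw [cycSum_succ]
  simp only [Nat.cast_zero, sub_zero, Int.natCast_dvd_natCast]
  rfl

lemma TupleLE.refl {k : ℕ} (s : Fin k → ℕ) : TupleLE s s := ⟨id, strictMono_id, fun _ => le_rfl⟩

lemma TupleLE.trans {a b c : ℕ} {s : Fin a → ℕ} {t : Fin b → ℕ} {u : Fin c → ℕ}
    (h1 : TupleLE s t) (h2 : TupleLE t u) : TupleLE s u := by
  obtain ⟨j, hj, h⟩ := h1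
  obtain ⟨j', hj', h'⟩ := h2
  exact ⟨j' ∘ j, hj'.comp hj, fun x => (h x).trans (h' _)⟩

lemma TupleLE.init {k : ℕ} (s : Fin (k + 1) → ℕ) : TupleLE (Fin.init s) s :=
  ⟨Fin.castSucc, fun _ _ h => Fin.castSucc_lt_castSucc_iff.2 h, fun _ => le_rfl⟩

lemma TupleLE.snoc {l k : ℕ} {t : Fin l → ℕ} {s : Fin (k + 1) → ℕ} (h : TupleLE t (Fin.init s))
    {e : ℕ} (he : e ≤ s (Fin.last k)) : TupleLE (Fin.snoc (α := fun _ => ℕ) t e) s := by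
  obtain ⟨j, hj, h⟩ := h
  refine ⟨Fin.snoc (α := fun _ => Fin (k + 1)) (fun x => (j x).castSucc) (Fin.last k), ?_, ?_⟩
  · intro a b hab
    induction b using Fin.lastCases with
    | last =>
      induction a using Fin.lastCases with
      | last => exact absurd hab (lt_irrefl _)
      | cast a => simpa using Fin.castSucc_lt_last _
    | cast b =>
      induction a using Fin.lastCases with
      | last => exact absurd hab (not_lt.2 (Fin.le_last _))
      | cast a => simpa using hj (Fin.castSucc_lt_castSucc_iff.1 hab)
  · intro a
    induction a using Fin.lastCases with
    | last => simpa using he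
    | cast a => simpa [Fin.init] using h a

lemma TupleLE.snoc' {l : ℕ} {t : Fin l → ℕ} {e e' : ℕ} (he : e ≤ e') :
    TupleLE (Fin.snoc (α := fun _ => ℕ) t e) (Fin.snoc (α := fun _ => ℕ) t e' : Fin (l + 1) → ℕ) :=
  TupleLE.snoc (by rw [Fin.init_snoc]; exact TupleLE.refl t) (by simpa using he)

/-- The span of the `σ_p(t;j)` with `t ≤ s` over the good functions. -/
inductive WFn (p M : ℕ) [NormedField K] (ζ : K) {k : ℕ} (s : Fin k → ℕ) : (ℕ → K) → Prop
  | zero : WFn p M ζ s (fun _ => 0)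
  | add (F G : ℕ → K) (hF : WFn p M ζ s F) (hG : WFn p M ζ s G) : WFn p M ζ s (fun n => F n + G n)
  | gen (f : ℕ → K) (hf : AFn (p * M) f) (u : SIdx M) (hu : TupleLE u.2.1 s) :
      WFn p M ζ s (fun n => f n * sigmaPIdx p M ζ u n)

/-- The standing facts about the field. -/
structure Ctx (p M : ℕ) [NormedField K] (ζ : K) : Prop where
  hp : 1 < p
  hM : 0 < M
  hn : ∀ n : ℕ, ‖(n : K)‖ ≤ 1
  hinv : ∀ k : ℕ, ‖((k : K) + 1)⁻¹‖ ≤ k + 1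
  hu : ∀ a : ℕ, ¬ p ∣ a → ‖(a : K)‖ = 1
  hMu : ‖(M : K)‖ = 1
  hpM : ‖((p * M : ℕ) : K)‖ = (p : ℝ)⁻¹
  hζ : ζ ^ M = 1
  hζp : IsPrimitiveRoot (ζ ^ p) M

section
variable [NormedField K] {p M : ℕ} {ζ : K}

lemma WFn.congr {k : ℕ} {s : Fin k → ℕ} {F G : ℕ → K} (hF : WFn p M ζ s F) (h : ∀ n, G n = F n) :
    WFn p M ζ s G := by
  have : G = F := funext h
  rwa [this]

lemma WFn.mono {k l : ℕ} {s : Fin k → ℕ} {t : Fin l → ℕ} {F : ℕ → K} (hF : WFn p M ζ t F)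
    (h : TupleLE t s) : WFn p M ζ s F := by
  induction hF with
  | zero => exact .zero
  | add F G _ _ ih1 ih2 => exact .add _ _ ih1 ih2
  | gen f hf u hu => exact .gen f hf u (hu.trans h)

lemma WFn.sum {k : ℕ} {s : Fin k → ℕ} {ι : Type*} (S : Finset ι) (F : ι → ℕ → K)
    (hF : ∀ j ∈ S, WFn p M ζ s (F j)) : WFn p M ζ s (fun n => ∑ j ∈ S, F j n) := by
  classical
  induction S using Finset.induction_on with
  | empty => simpa using WFn.zero
  | insert j S hj ih =>
    simp only [Finset.sum_insert hj]
    exact .add _ _ (hF j (by simp)) (ih fun k hk => hF k (by simp [hk]))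

variable [CompleteSpace K]

lemma WFn.smul (H : Ctx p M ζ) {k : ℕ} {s : Fin k → ℕ} {F : ℕ → K} (hF : WFn p M ζ s F) {f : ℕ → K}
    (hf : AFn (p * M) f) : WFn p M ζ s (fun n => f n * F n) := by
  induction hF with
  | zero => exact WFn.zero.congr fun n => by simp
  | add F G _ _ ih1 ih2 => exact (WFn.add _ _ ih1 ih2).congr fun n => by ring
  | gen g hg u hu => exact (WFn.gen _ (hf.mul H.hn hg) u hu).congr fun n => by ring

lemma AFn.dvd_ind (f : ℕ → K) (c : ℕ) (h : ∀ a b, f (a + p * M * b) = f a) :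
    AFn (p * M) (fun a => if (p : ℤ) ∣ (a : ℤ) - c then f a else 0) := by
  refine AFn.periodic fun a b => ?_
  have : (p : ℤ) ∣ ((a + p * M * b : ℕ) : ℤ) - c ↔ (p : ℤ) ∣ (a : ℤ) - c := by
    have e : ((a + p * M * b : ℕ) : ℤ) - c = ((a : ℤ) - c) + p * (M * b) := by push_cast; ring
    rw [e]
    exact (Int.dvd_add_left (Dvd.intro _ rfl))
  simp only [this, h]

lemma zeta_periodic (hζ : ζ ^ M = 1) (j a b : ℕ) :
    ζ ^ (j * (a + p * M * b)) = ζ ^ (j * a) := by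
  have : j * (a + p * M * b) = j * a + M * (j * p * b) := by ring
  rw [this, pow_add, pow_mul ζ M, hζ, one_pow, mul_one]

lemma AFn.zeta (H : Ctx p M ζ) (j : ℕ) : AFn (p * M) (fun a => ζ ^ (j * a)) :=
  AFn.periodic fun a b => zeta_periodic H.hζ j a b

/-- The contribution of a periodic function. -/
lemma WFn.periodic_part (H : Ctx p M ζ) {l : ℕ} (t : Fin l → ℕ) (j : Fin l → Fin M)
    (κ : ℕ → K) (e : ℕ) :
    WFn p M ζ (Fin.snoc (α := fun _ => ℕ) t e : Fin (l + 1) → ℕ) (fun n => ∑ a ∈ Finset.range n,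
      (if 0 < a ∧ p ∣ a then κ ((a / p) % M) / (a : K) ^ e else 0)
        * sigmaPIdx p M ζ ⟨l, t, j⟩ a) := by
  obtain ⟨c, hc⟩ := exists_fourier H.hM H.hζp κ
  have h := WFn.sum (p := p) (M := M) (ζ := ζ)
    (s := (Fin.snoc (α := fun _ => ℕ) t e : Fin (l + 1) → ℕ)) Finset.univ
    (fun (x : Fin M) n => c x * sigmaPIdx p M ζ ⟨l + 1, Fin.snoc (α := fun _ => ℕ) t e,
      Fin.snoc (α := fun _ => Fin M) j x⟩ n)
    (fun x _ => WFn.gen _ (AFn.const (c x)) _ (TupleLE.refl _))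
  refine h.congr fun n => ?_
  simp only [sigmaPIdx_succ, Fin.snoc_last, Fin.init_snoc, Finset.mul_sum]
  rw [Finset.sum_comm]
  refine Finset.sum_congr rfl fun a _ => ?_
  by_cases ha : 0 < a ∧ p ∣ a
  · simp only [if_pos ha]
    obtain ⟨_, a', rfl⟩ := ha
    rw [Nat.mul_div_cancel_left _ (by linarith [H.hp]), hc, ← Fin.sum_univ_eq_sum_range
      (fun x => c x * (ζ ^ p) ^ (x * a')), Finset.sum_div, Finset.sum_mul]
    refine Finset.sum_congr rfl fun x _ => ?_
    rw [← pow_mul, mul_left_comm p]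
    ring
  · simp only [if_neg ha]; simp

/-- Multiplication by inverse powers, given the summation lemma for the inner tuple. -/
lemma WFn.polar_part [CharZero K] (H : Ctx p M ζ) {l : ℕ} (t : Fin l → ℕ) (j : Fin l → Fin M)
    (hS : ∀ g : ℕ → K, AFn (p * M) g → WFn p M ζ t
      (fun n => ∑ a ∈ Finset.range n, g a * sigmaPIdx p M ζ ⟨l, t, j⟩ a))
    (e : ℕ) : ∀ f : ℕ → K, AFn (p * M) f →
    WFn p M ζ (Fin.snoc (α := fun _ => ℕ) t e : Fin (l + 1) → ℕ) (fun n => ∑ a ∈ Finset.range n,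
      (if 0 < a ∧ p ∣ a then f a / (a : K) ^ e else 0) * sigmaPIdx p M ζ ⟨l, t, j⟩ a) := by
  have hp0 : 0 < p := by linarith [H.hp]
  induction e with
  | zero =>
    intro f hf
    obtain ⟨κ, g, hg, h⟩ := hf.div_id H.hn hp0 H.hM H.hMu
    have hg' : AFn (p * M) (fun a => (if (p : ℤ) ∣ (a : ℤ) - (0 : ℕ) then (1 : K) else 0)
        * ((a : K) * g a)) :=
      (AFn.dvd_ind (fun _ => (1 : K)) 0 fun _ _ => rfl).mul H.hn ((AFn.id H.hn).mul H.hn hg)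
    have hle : TupleLE t (Fin.snoc (α := fun _ => ℕ) t 0 : Fin (l + 1) → ℕ) := by
      have := TupleLE.init (Fin.snoc (α := fun _ => ℕ) t 0 : Fin (l + 1) → ℕ)
      rwa [Fin.init_snoc] at this
    refine (WFn.add _ _ (WFn.periodic_part H t j κ 0) ((hS _ hg').mono hle)).congr fun n => ?_
    rw [← Finset.sum_add_distrib]
    refine Finset.sum_congr rfl fun a _ => ?_
    rw [← add_mul]
    congr 1
    simp only [Nat.cast_zero, sub_zero, Int.natCast_dvd_natCast]
    by_cases hpa : p ∣ a
    · obtain ⟨a', rfl⟩ := hpa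
      rcases Nat.eq_zero_or_pos a' with rfl | ha'
      · simp
      · have hpos : 0 < p * a' := Nat.mul_pos hp0 ha'
        simp only [hpos, dvd_mul_right, and_self, if_true, pow_zero, div_one, one_mul,
          Nat.mul_div_cancel_left _ hp0]
        exact h a'
    · simp [hpa]
  | succ e ih =>
    intro f hf
    obtain ⟨κ, g, hg, h⟩ := hf.div_id H.hn hp0 H.hM H.hMu
    refine (WFn.add _ _ (WFn.periodic_part H t j κ (e + 1))
      ((ih g hg).mono (TupleLE.snoc' (Nat.le_succ e)))).congr fun n => ?_
    rw [← Finset.sum_add_distrib]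
    refine Finset.sum_congr rfl fun a _ => ?_
    rw [← add_mul]
    congr 1
    by_cases ha : 0 < a ∧ p ∣ a
    · simp only [if_pos ha]
      obtain ⟨hpos, a', rfl⟩ := ha
      have hne : ((p * a' : ℕ) : K) ≠ 0 := Nat.cast_ne_zero.2 hpos.ne'
      rw [h a', Nat.mul_div_cancel_left _ hp0]
      generalize ((p * a' : ℕ) : K) = z at hne
      field_simp
      ring
    · simp only [if_neg ha, add_zero]

/-- Summation by parts. -/
lemma sum_by_parts (g h S : ℕ → K) (n : ℕ) :
    ∑ a ∈ Finset.range n, g a * (∑ b ∈ Finset.range a, h b * S b)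
      = (∑ a ∈ Finset.range n, g a) * (∑ b ∈ Finset.range n, h b * S b)
        - ∑ b ∈ Finset.range n, h b * (∑ a ∈ Finset.range (b + 1), g a) * S b := by
  induction n with
  | zero => simp
  | succ n ih =>
    rw [Finset.sum_range_succ, ih, Finset.sum_range_succ g, Finset.sum_range_succ (fun b => h b * S b),
      Finset.sum_range_succ (fun b => h b * _ * S b), Finset.sum_range_succ g]
    ring

lemma WFn.sum_gen [CharZero K] [IsUltrametricDist K] (H : Ctx p M ζ) {l : ℕ} :
    ∀ (t : Fin l → ℕ) (j : Fin l → Fin M) (g : ℕ → K), AFn (p * M) g →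
      WFn p M ζ t (fun n => ∑ a ∈ Finset.range n, g a * sigmaPIdx p M ζ ⟨l, t, j⟩ a) := by
  induction l with
  | zero =>
    intro t j g hg
    refine (WFn.gen _ (hg.indefSum H.hn H.hinv) ⟨0, t, j⟩ (TupleLE.refl _)).congr fun n => ?_
    simp [sigmaPIdx, sigmaP, cycSum_zero]
  | succ l ih =>
    intro t j g hg
    have hG := hg.indefSum H.hn H.hinv
    have h1 := WFn.gen (ζ := ζ) _ hG ⟨l + 1, t, j⟩ (TupleLE.refl t)
    have h2 := WFn.polar_part H (Fin.init t) (Fin.init j) (ih (Fin.init t) (Fin.init j))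
      (t (Fin.last l)) _ ((AFn.zeta H (j (Fin.last l))).mul H.hn hG.succ)
    rw [Fin.snoc_init_self] at h2
    refine (WFn.add _ _ h1 (h2.smul H (AFn.const (-1)))).congr fun n => ?_
    beta_reduce
    simp only [sigmaPIdx_succ]
    rw [sum_by_parts, sub_eq_add_neg, neg_one_mul]
    congr 2
    refine Finset.sum_congr rfl fun b _ => ?_
    congr 1
    split_ifs
    · ring
    · ring

lemma WFn.sum_of [CharZero K] [IsUltrametricDist K] (H : Ctx p M ζ) {k : ℕ} {s : Fin k → ℕ}
    {F : ℕ → K} (hF : WFn p M ζ s F) {g : ℕ → K} (hg : AFn (p * M) g) :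
    WFn p M ζ s (fun n => ∑ a ∈ Finset.range n, g a * F a) := by
  induction hF with
  | zero => exact WFn.zero.congr fun n => by simp
  | add F G _ _ ih1 ih2 =>
    exact (WFn.add _ _ ih1 ih2).congr fun n => by simp only [mul_add, Finset.sum_add_distrib]
  | gen f hf u hu =>
    obtain ⟨l, t, j⟩ := u
    refine ((WFn.sum_gen H t j _ (hg.mul H.hn hf)).mono hu).congr fun n => ?_
    simp only [mul_assoc]

lemma WFn.polar_of [CharZero K] [IsUltrametricDist K] (H : Ctx p M ζ) {k : ℕ} {s : Fin (k + 1) → ℕ}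
    {F : ℕ → K} (hF : WFn p M ζ (Fin.init s) F) {g : ℕ → K} (hg : AFn (p * M) g) :
    WFn p M ζ s (fun n => ∑ a ∈ Finset.range n,
      (if 0 < a ∧ p ∣ a then g a / (a : K) ^ s (Fin.last k) else 0) * F a) := by
  induction hF with
  | zero => exact WFn.zero.congr fun n => by simp
  | add F G _ _ ih1 ih2 =>
    exact (WFn.add _ _ ih1 ih2).congr fun n => by simp only [mul_add, Finset.sum_add_distrib]
  | gen f hf u hu =>
    obtain ⟨l, t, j⟩ := u
    refine ((WFn.polar_part H t j (WFn.sum_gen H t j) (s (Fin.last k)) _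
      (hg.mul H.hn hf)).mono (TupleLE.snoc hu le_rfl)).congr fun n => ?_
    refine Finset.sum_congr rfl fun a _ => ?_
    split_ifs <;> ring

lemma WFn.cycSum [CharZero K] [IsUltrametricDist K] (H : Ctx p M ζ) {k : ℕ} :
    ∀ s i m : Fin k → ℕ, (∀ b, m b < p) → WFn p M ζ s (cycSum p ζ s i m) := by
  induction k with
  | zero =>
    intro s i m _
    refine (WFn.gen (ζ := ζ) _ (AFn.const 1) ⟨0, s, fun x => x.elim0⟩ (TupleLE.refl s)).congr
      fun n => ?_
    simp [sigmaPIdx, sigmaP, cycSum_zero]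
  | succ k ih =>
    intro s i m hm
    have hF := ih (Fin.init s) (Fin.init i) (Fin.init m) fun b => hm _
    by_cases h0 : m (Fin.last k) = 0
    · refine (hF.polar_of H (AFn.zeta H (i (Fin.last k)))).congr fun n => ?_
      rw [cycSum_succ]
      simp only [h0, Nat.cast_zero, sub_zero, Int.natCast_dvd_natCast]
    · have hpm : ¬ (p : ℤ) ∣ (m (Fin.last k) : ℤ) := by
        rw [Int.natCast_dvd_natCast]
        exact Nat.not_dvd_of_pos_of_lt (Nat.pos_of_ne_zero h0) (hm _)
      have hd : ‖((p * M : ℕ) : K)‖ < 1 := by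
        rw [H.hpM]
        exact inv_lt_one_of_one_lt₀ (by exact_mod_cast H.hp)
      have hg := (AFn.dvd_ind (p := p) (M := M) (fun a => ζ ^ (i (Fin.last k) * a))
        (m (Fin.last k)) (fun a b => zeta_periodic H.hζ _ a b)).mul H.hn
        ((AFn.inv H.hn (Dvd.intro M rfl) H.hu hd).pow H.hn (s (Fin.last k)))
      refine ((hF.sum_of H hg).mono (TupleLE.init s)).congr fun n => ?_
      rw [cycSum_succ]
      refine Finset.sum_congr rfl fun a _ => ?_
      congr 1
      by_cases hpa : (p : ℤ) ∣ (a : ℤ) - (m (Fin.last k) : ℤ)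
      · have hna : ¬ p ∣ a := by
          intro h
          apply hpm
          have := dvd_sub (Int.natCast_dvd_natCast.2 h) hpa
          simpa using this
        have ha : 0 < a := by
          rcases Nat.eq_zero_or_pos a with rfl | h
          · exact absurd (dvd_zero p) hna
          · exact h
        rw [if_pos ⟨ha, hpa⟩, if_pos hpa, if_neg hna, inv_pow, div_eq_mul_inv]
      · rw [if_neg (fun h => hpa h.2), if_neg hpa, zero_mul]

lemma WFn.exists_finset (H : Ctx p M ζ) {k : ℕ} {s : Fin k → ℕ} {F : ℕ → K}
    (hF : WFn p M ζ s F) :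
    ∃ (T : Finset (SIdx M)) (c : SIdx M → ℕ → K),
      (∀ u ∈ T, AFn (p * M) (c u) ∧ TupleLE u.2.1 s) ∧
      ∀ n : ℕ, F n = ∑ u ∈ T, c u n * sigmaPIdx p M ζ u n := by
  classical
  induction hF with
  | zero => exact ⟨∅, fun _ _ => 0, by simp, by simp⟩
  | gen f hf u hu =>
    refine ⟨{u}, fun _ => f, ?_, by simp⟩
    intro v hv
    rw [Finset.mem_singleton.1 hv]
    exact ⟨hf, hu⟩
  | add F G _ _ ih1 ih2 =>
    obtain ⟨T1, c1, h1, e1⟩ := ih1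
    obtain ⟨T2, c2, h2, e2⟩ := ih2
    refine ⟨T1 ∪ T2, fun u n => (if u ∈ T1 then c1 u n else 0) + (if u ∈ T2 then c2 u n else 0),
      ?_, ?_⟩
    · intro u hu
      constructor
      · refine AFn.add H.hn ?_ ?_
        · by_cases h : u ∈ T1
          · simpa only [if_pos h] using (h1 u h).1
          · simpa only [if_neg h] using AFn.const (0 : K)
        · by_cases h : u ∈ T2
          · simpa only [if_pos h] using (h2 u h).1
          · simpa only [if_neg h] using AFn.const (0 : K)
      · rcases Finset.mem_union.1 hu with h | h
        · exact (h1 u h).2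
        · exact (h2 u h).2
    · intro n
      simp only [add_mul, ite_mul, zero_mul, Finset.sum_add_distrib]
      rw [e1, e2, Finset.sum_ite_mem, Finset.sum_ite_mem, Finset.union_inter_cancel_left,
        Finset.union_inter_cancel_right]

end

lemma mkCtx (p M : ℕ) [Fact p.Prime] (hM : 1 ≤ M) (hpM : ¬ p ∣ M)
    [NormedField K] [Algebra ℚ_[p] K]
    (hiso : ∀ x : ℚ_[p], ‖algebraMap ℚ_[p] K x‖ = ‖x‖)
    (ζ : K) (hζ : IsPrimitiveRoot ζ M) : Ctx p M ζ := by
  have hp : p.Prime := Fact.out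
  have hnat : ∀ n : ℕ, ‖(n : K)‖ = ‖(n : ℚ_[p])‖ := by
    intro n
    rw [← hiso, map_natCast]
  have hu : ∀ a : ℕ, ¬ p ∣ a → ‖(a : K)‖ = 1 := by
    intro a ha
    rw [hnat, Padic.norm_natCast_eq_one_iff]
    exact (Nat.Prime.coprime_iff_not_dvd hp).2 ha
  have hn : ∀ n : ℕ, ‖(n : K)‖ ≤ 1 := by
    intro n
    rw [hnat]
    exact_mod_cast Padic.norm_int_le_one (p := p) (n : ℤ)
  refine ⟨hp.one_lt, hM, hn, ?_, hu, hu M hpM, ?_, hζ.pow_eq_one, ?_⟩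
  · intro k
    have e : ((k : K) + 1) = ((k + 1 : ℕ) : K) := by push_cast; rfl
    have hne : ((k + 1 : ℕ) : ℚ_[p]) ≠ 0 := Nat.cast_ne_zero.2 (Nat.succ_ne_zero k)
    rw [e, norm_inv, hnat, Padic.norm_eq_zpow_neg_valuation hne, Padic.valuation_natCast, zpow_neg,
      inv_inv, zpow_natCast]
    have := Nat.le_of_dvd (Nat.succ_pos k) (pow_padicValNat_dvd (p := p) (n := k + 1))
    exact_mod_cast this
  · rw [Nat.cast_mul, norm_mul, hu M hpM, mul_one, hnat, Padic.norm_p]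
  · exact hζ.pow_of_coprime p ((Nat.Prime.coprime_iff_not_dvd hp).2 hpM)

/-- each cyclotomic `p`-adic iterated sum series `σ(s;i;m)` lies in `F_{M,σ}`:
it is a finite combination `∑ c_{(t,j)} σ_p(t;j)` with `M`-power series coefficients
`c_{(t,j)}`, and the indexing tuples can be chosen with `t ≤ s`. -/
theorem cycSum_mem_FMsigma (p M : ℕ) [Fact p.Prime] (hM : 1 ≤ M) (hpM : ¬ p ∣ M)
    [NormedField K] [CompleteSpace K] [Algebra ℚ_[p] K]
    (hiso : ∀ x : ℚ_[p], ‖algebraMap ℚ_[p] K x‖ = ‖x‖)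
    (ζ : K) (hζ : IsPrimitiveRoot ζ M) (hgen : Algebra.adjoin ℚ_[p] {ζ} = ⊤)
    (k : ℕ) (hk : 1 ≤ k) (s i m : Fin k → ℕ)
    (hi : ∀ b, i b < M) (hm : ∀ b, m b < p) :
    ∃ (T : Finset (SIdx M)) (c : SIdx M → ℕ → K),
      (∀ u ∈ T, IsMPSF p M 0 (c u) ∧ TupleLE u.2.1 s) ∧
      ∀ n : ℕ, cycSum p ζ s i m n = ∑ u ∈ T, c u n * sigmaPIdx p M ζ u n := by
  have H := mkCtx p M hM hpM hiso ζ hζ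
  haveI : CharZero K := charZero_of_injective_algebraMap (algebraMap ℚ_[p] K).injective
  haveI : IsUltrametricDist K :=
    IsUltrametricDist.isUltrametricDist_of_forall_norm_natCast_le_one H.hn
  obtain ⟨T, c, h1, h2⟩ := (WFn.cycSum H s i m hm).exists_finset H
  have hp0 : 0 < p := (Fact.out : p.Prime).pos
  exact ⟨T, c, fun u hu => ⟨(h1 u hu).1.isMPSF H.hn hp0 H.hM H.hpM, (h1 u hu).2⟩, h2⟩

end
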